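/- Let H = {0, 89, 178, 267, 356, 445, 534} ⊆ ℤ/623ℤ and let B = {0, 1, 4, 11, 272, 343, 370, 519} ⊆ ℤ/623ℤ. Then H is a subgroup of ℤ/623ℤ of order 7, and the eleven difference sets Δ(8ⁱ·B) for i = 0, 1, …, 10 are pairwise disjoint, each has cardinality 56, each is disjoint from H, and their union together with H \ {0} is (ℤ/623ℤ) \ {0}. -/

import Mathlib

/-- The set of differences `ΔB = {a - c : a, c ∈ B, a ≠ c}`. -/
def diffSet (B : Finset (ZMod 623)) : Finset (ZMod 623) :=
  ((B ×ˢ B).filter fun p => p.1 ≠ p.2).image fun p => p.1 - p.2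

/-- The subgroup block `H = {0, 89, 178, 267, 356, 445, 534}` of `ℤ/623ℤ`. -/
def Hblock : Finset (ZMod 623) := {0, 89, 178, 267, 356, 445, 534}

/-- The base block `B`. -/
def baseBlock : Finset (ZMod 623) := {0, 1, 4, 11, 272, 343, 370, 519}

/-- The dilates `8ⁱ · B` of the base block, for `i = 0, 1, …, 10`. -/
def dilate (i : Fin 11) : Finset (ZMod 623) :=
  baseBlock.image fun x => (8 : ZMod 623) ^ (i : ℕ) * x

/-- Multiplication by a power of `8` is injective modulo `623`. -/
theorem eight_pow_mul_injective (i : ℕ) :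
    Function.Injective fun x : ZMod 623 => 8 ^ i * x := by
  have h8 : IsUnit (8 : ZMod 623) := IsUnit.of_mul_eq_one (78 : ZMod 623) (by decide +kernel)
  exact (h8.pow i).mul_right_injective

theorem diffSet_dilate (i : Fin 11) :
    diffSet (dilate i) =
      baseBlock.offDiag.image fun p => (8 : ZMod 623) ^ (i : ℕ) * (p.1 - p.2) := by
  ext x
  simp only [diffSet, dilate, Finset.mem_image, Finset.mem_filter, Finset.mem_product,
    Finset.mem_offDiag, Prod.exists]
  constructor
  · rintro ⟨_, _, ⟨⟨⟨a, ha, rfl⟩, c, hc, rfl⟩, hne⟩, rfl⟩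
    exact ⟨a, c, ⟨ha, hc, fun h => hne (by rw [h])⟩, mul_sub _ _ _⟩
  · rintro ⟨a, c, ⟨ha, hc, hne⟩, rfl⟩
    exact ⟨_, _, ⟨⟨⟨a, ha, rfl⟩, c, hc, rfl⟩, (eight_pow_mul_injective i).ne hne⟩,
      (mul_sub _ _ _).symm⟩

theorem mem_Hblock_iff : ∀ x : ZMod 623, x ∈ Hblock ↔ 7 * x = 0 := by
  decide +kernel

/-- The least nonnegative representatives of the base block. -/
def baseList : List ℕ := [0, 1, 4, 11, 272, 343, 370, 519]

theorem exists_mem_baseList {x : ZMod 623} (hx : x ∈ baseBlock) :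
    ∃ a ∈ baseList, (a : ZMod 623) = x := by
  simp only [baseBlock, Finset.mem_insert, Finset.mem_singleton] at hx
  rcases hx with rfl | rfl | rfl | rfl | rfl | rfl | rfl | rfl <;> simp [baseList]

theorem exists_natCast_of_mem_offDiag {p : ZMod 623 × ZMod 623} (hp : p ∈ baseBlock.offDiag) :
    ∃ a ∈ baseList, ∃ c ∈ baseList, a ≠ c ∧ p = (↑a, ↑c) ∧
      p.1 - p.2 = ((a + (623 - c) : ℕ) : ZMod 623) := by
  obtain ⟨ha, hc, hne⟩ := Finset.mem_offDiag.1 hp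
  obtain ⟨a, ha, hpa⟩ := exists_mem_baseList ha
  obtain ⟨c, hc, hpc⟩ := exists_mem_baseList hc
  refine ⟨a, ha, c, hc, ?_, Prod.ext hpa.symm hpc.symm, ?_⟩
  · rintro rfl
    exact hne (hpa.symm.trans hpc)
  · have hc' : ∀ c ∈ baseList, c ≤ 623 := by decide
    rw [← hpa, ← hpc, Nat.cast_add, Nat.cast_sub (hc' c hc), ZMod.natCast_self, zero_sub,
      sub_eq_add_neg]

/-- No difference of the base block is divisible by `89`, in the form given by Fermat's little
theorem modulo `89`. -/
theorem seven_mul_sub_pow {p : ZMod 623 × ZMod 623} (hp : p ∈ baseBlock.offDiag) :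
    (7 : ZMod 623) * (p.1 - p.2) ^ 88 = 7 := by
  have key : ∀ a ∈ baseList, ∀ c ∈ baseList, a ≠ c →
      7 * (a + (623 - c)) ^ 88 % 623 = 7 % 623 := by
    decide +kernel
  obtain ⟨a, ha, c, hc, hac, -, h⟩ := exists_natCast_of_mem_offDiag hp
  rw [h]
  exact_mod_cast (ZMod.natCast_eq_natCast_iff' _ _ 623).2 (key a ha c hc hac)

/-- The differences of the base block have distinct `11`-th powers. As `8 ^ 11 = 1`, they thus
lie in distinct orbits under multiplication by `8`. -/
theorem sub_pow_eleven_injOn {p q : ZMod 623 × ZMod 623} (hp : p ∈ baseBlock.offDiag)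
    (hq : q ∈ baseBlock.offDiag) (hpq : (p.1 - p.2) ^ 11 = (q.1 - q.2) ^ 11) : p = q := by
  have key : ∀ a ∈ baseList, ∀ c ∈ baseList, a ≠ c → ∀ b ∈ baseList, ∀ d ∈ baseList, b ≠ d →
      (a + (623 - c)) ^ 11 % 623 = (b + (623 - d)) ^ 11 % 623 → a = b ∧ c = d := by
    decide +kernel
  obtain ⟨a, ha, c, hc, hac, rfl, h⟩ := exists_natCast_of_mem_offDiag hp
  obtain ⟨b, hb, d, hd, hbd, rfl, h'⟩ := exists_natCast_of_mem_offDiag hq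
  rw [h, h', ← Nat.cast_pow, ← Nat.cast_pow, ZMod.natCast_eq_natCast_iff'] at hpq
  obtain ⟨rfl, rfl⟩ := key a ha c hc hac b hb d hd hbd hpq
  rfl

theorem seven_mul_eight_pow_injective :
    ∀ i j : Fin 11, (7 : ZMod 623) * 8 ^ (i : ℕ) = 7 * 8 ^ (j : ℕ) → i = j := by
  decide +kernel

theorem eight_pow_mul_sub_inj {i j : Fin 11} {p q : ZMod 623 × ZMod 623}
    (hp : p ∈ baseBlock.offDiag) (hq : q ∈ baseBlock.offDiag)
    (h : (8 : ZMod 623) ^ (i : ℕ) * (p.1 - p.2) = 8 ^ (j : ℕ) * (q.1 - q.2)) :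
    i = j ∧ p = q := by
  have h8 : (8 : ZMod 623) ^ 11 = 1 := by decide +kernel
  have hpq : p = q := by
    refine sub_pow_eleven_injOn hp hq ?_
    have h' := congrArg (· ^ 11) h
    simpa only [mul_pow, pow_right_comm _ _ 11, h8, one_pow, one_mul] using h'
  subst hpq
  refine ⟨seven_mul_eight_pow_injective i j ?_, rfl⟩
  rw [← seven_mul_sub_pow hp]
  generalize p.1 - p.2 = x at h
  linear_combination 7 * x ^ 87 * h

theorem card_diffSet_dilate (i : Fin 11) : (diffSet (dilate i)).card = 56 := by
  rw [diffSet_dilate, Finset.card_image_of_injOn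
    fun p hp q hq h => (eight_pow_mul_sub_inj hp hq h).2]
  decide +kernel

theorem disjoint_diffSet_dilate {i j : Fin 11} (hij : i ≠ j) :
    Disjoint (diffSet (dilate i)) (diffSet (dilate j)) := by
  rw [diffSet_dilate, diffSet_dilate, Finset.disjoint_left]
  simp only [Finset.mem_image]
  rintro _ ⟨p, hp, rfl⟩ ⟨q, hq, h⟩
  exact hij (eight_pow_mul_sub_inj hq hp h).1.symm

theorem disjoint_diffSet_dilate_Hblock (i : Fin 11) :
    Disjoint (diffSet (dilate i)) Hblock := by
  rw [diffSet_dilate, Finset.disjoint_left]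
  simp only [Finset.mem_image]
  rintro _ ⟨p, hp, rfl⟩ h
  rw [mem_Hblock_iff] at h
  have h0 : (8 : ZMod 623) ^ (i : ℕ) * 7 = 8 ^ (i : ℕ) * 0 := by
    rw [← seven_mul_sub_pow hp]
    generalize p.1 - p.2 = x at h
    linear_combination x ^ 87 * h
  exact absurd (eight_pow_mul_injective i h0) (by decide)

theorem card_Hblock : Hblock.card = 7 := by
  decide

theorem biUnion_diffSet_dilate :
    (Finset.univ.biUnion fun i => diffSet (dilate i)) = Hblockᶜ := by
  refine Finset.eq_of_subset_of_card_le ?_ ?_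
  · refine Finset.biUnion_subset.2 fun i _ => ?_
    exact Finset.subset_compl_iff_disjoint_right.2 (disjoint_diffSet_dilate_Hblock i)
  · rw [Finset.card_biUnion fun i _ j _ hij => disjoint_diffSet_dilate hij,
      Finset.card_compl, card_Hblock, ZMod.card]
    simp [card_diffSet_dilate]

/-- `H` is a subgroup of `ℤ/623ℤ` of order `7`, and the eleven difference sets
`Δ(8ⁱ · B)`, `i = 0, …, 10`, are pairwise disjoint, each has cardinality `56`,
each is disjoint from `H`, and their union together with `H \ {0}` is
`ℤ/623ℤ \ {0}`. -/
theorem one_rotational_difference_family_zmod_623_13 :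
    (∃ S : AddSubgroup (ZMod 623), (S : Set (ZMod 623)) = (Hblock : Set (ZMod 623))) ∧
    Hblock.card = 7 ∧
    (∀ i j, i ≠ j → Disjoint (diffSet (dilate i)) (diffSet (dilate j))) ∧
    (∀ i, (diffSet (dilate i)).card = 56) ∧
    (∀ i, Disjoint (diffSet (dilate i)) Hblock) ∧
    (Hblock \ {0}) ∪ (Finset.univ.biUnion fun i => diffSet (dilate i)) =
      Finset.univ \ {0} := by
  refine ⟨⟨(AddMonoidHom.mulLeft (7 : ZMod 623)).ker, ?_⟩, card_Hblock,
    fun i j => disjoint_diffSet_dilate, card_diffSet_dilate, disjoint_diffSet_dilate_Hblock, ?_⟩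
  · ext x
    simp [AddMonoidHom.mem_ker, mem_Hblock_iff]
  · have h0 : (0 : ZMod 623) ∈ Hblock := by simp [mem_Hblock_iff]
    rw [biUnion_diffSet_dilate]
    ext x
    by_cases hx : x = 0
    · simp [hx, h0]
    · simp [hx, em]
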